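/- arXiv:2104.01743 — 3 statements merged into one kernel-verified Lean document; each statement's English description precedes it below -/
import Mathlib

section
/- Let F : V^m → V^m and suppose the state transition diagram of G_F is strongly connected. Then for every nonempty open set U ⊆ 𝓔 there exists a positive integer n₀ such that G_F^{n₀}(U) = 𝓔. -/
/-!
Fix integers m ≥ 1, P ≥ 0, Q ≥ 0 with N = P + Q ≥ 1.  We identify the set
V = {k·2^{−Q} : k = 0,…,2^N−1} of N-bit fixed-point numbers with `BitVec N`,
an N-bit word `b` corresponding to the real number `b.toNat / 2^Q`;
bitwise AND, OR and NOT are the `BitVec` operations `&&&`, `|||`, `~~~`.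
A one-sided sequence is a map `ℕ → BitVec N` (index `k` representing `w^{k+1}`);
the left shift σ sends `w` to `fun k => w (k + 1)`.
The phase space is `𝓔 = (ℕ → BitVec N)^m × (BitVec N)^m`; a subset of `𝓔` is
open iff around each of its points it contains an open ball of the metric `d`.
-/

/-- The real value of an N-bit fixed-point word, with Q fractional bits. -/
noncomputable def bvVal (Q : ℕ) {N : ℕ} (b : BitVec N) : ℝ := (b.toNat : ℝ) / 2 ^ Q

/-- The distance `d_w(w,ŵ) = Σ_{k=1}^∞ |w^k − ŵ^k| / 2^{Nk}` on one-sided sequences. -/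
noncomputable def dSeq (Q : ℕ) {N : ℕ} (w w2 : ℕ → BitVec N) : ℝ :=
  ∑' k : ℕ, |bvVal Q (w k) - bvVal Q (w2 k)| / 2 ^ (N * (k + 1))

/-- The metric on the phase space:
`d = Σ_j d_w(w_j, ŵ_j) + √(Σ_j (x_j − x̂_j)²)`. -/
noncomputable def dE (Q : ℕ) {m N : ℕ}
    (E E2 : (Fin m → ℕ → BitVec N) × (Fin m → BitVec N)) : ℝ :=
  (∑ j, dSeq Q (E.1 j) (E2.1 j)) +
    Real.sqrt (∑ j, (bvVal Q (E.2 j) - bvVal Q (E2.2 j)) ^ 2)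

/-- The map `G_F((w_1,…,w_m),(x_1,…,x_m)) = ((σw_1,…,σw_m),(y_1,…,y_m))`
where `y_j = (x_j · NOT(w_j^1)) + (F_j(x) · w_j^1)` bitwise. -/
def GF {m N : ℕ} (F : (Fin m → BitVec N) → (Fin m → BitVec N))
    (E : (Fin m → ℕ → BitVec N) × (Fin m → BitVec N)) :
    (Fin m → ℕ → BitVec N) × (Fin m → BitVec N) :=
  (fun j k => E.1 j (k + 1),
   fun j => (E.2 j &&& ~~~(E.1 j 0)) ||| (F E.2 j &&& E.1 j 0))

/-- The edge relation of the state transition diagram of `G_F`: there is an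
edge from `x` to `y` iff there exist masks `c_1,…,c_m` with
`y_j = (x_j · NOT c_j) + (F_j(x) · c_j)` bitwise for every `j`. -/
def stepRel {m N : ℕ} (F : (Fin m → BitVec N) → (Fin m → BitVec N))
    (x y : Fin m → BitVec N) : Prop :=
  ∃ c : Fin m → BitVec N, ∀ j, y j = (x j &&& ~~~(c j)) ||| (F x j &&& c j)

/-- The word family that follows `c` for `n` steps and continues with `w` from its start. -/
def splice {m N : ℕ} (n : ℕ) (c w : Fin m → ℕ → BitVec N) : Fin m → ℕ → BitVec N :=
  fun j k => if k < n then c j k else w j (k - n)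

theorem GF_iterate_splice {m N : ℕ} (F : (Fin m → BitVec N) → (Fin m → BitVec N)) (n : ℕ)
    (c w : Fin m → ℕ → BitVec N) (x : Fin m → BitVec N) :
    (GF F)^[n] (splice n c w, x) = (w, ((GF F)^[n] (c, x)).2) := by
  induction n generalizing c x with
  | zero => exact Prod.ext (by ext; simp [splice]) rfl
  | succ n ih =>
    have h : GF F (splice (n + 1) c w, x) =
        (splice n (fun j k => c j (k + 1)) w, (GF F (c, x)).2) := by
      refine Prod.ext ?_ ?_ <;> ext <;> simp [GF, splice]
    rw [Function.iterate_succ_apply, Function.iterate_succ_apply, h, ih]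
    rfl

/-- Some choice of masks drives the state `x` to the state `y` in exactly `n` steps. -/
def ReachIn {m N : ℕ} (F : (Fin m → BitVec N) → (Fin m → BitVec N)) (n : ℕ)
    (x y : Fin m → BitVec N) : Prop :=
  ∃ c : Fin m → ℕ → BitVec N, ((GF F)^[n] (c, x)).2 = y

theorem ReachIn.head {m N : ℕ} {F : (Fin m → BitVec N) → (Fin m → BitVec N)} {n : ℕ}
    {x y z : Fin m → BitVec N} (hxy : stepRel F x y) (hyz : ReachIn F n y z) :
    ReachIn F (n + 1) x z := by
  obtain ⟨a, ha⟩ := hxy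
  obtain ⟨c, hc⟩ := hyz
  refine ⟨fun j k => k.casesOn (a j) (c j), ?_⟩
  have h : GF F (fun j k => k.casesOn (a j) (c j), x) = (c, y) :=
    Prod.ext rfl (funext fun j => (ha j).symm)
  rw [Function.iterate_succ_apply, h, hc]

theorem stepRel_refl {m N : ℕ} (F : (Fin m → BitVec N) → (Fin m → BitVec N))
    (x : Fin m → BitVec N) : stepRel F x x :=
  ⟨fun _ => 0, fun j => by ext; simp⟩

theorem ReachIn.mono {m N : ℕ} {F : (Fin m → BitVec N) → (Fin m → BitVec N)} {n k : ℕ}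
    {x y : Fin m → BitVec N} (h : ReachIn F n x y) (hnk : n ≤ k) : ReachIn F k x y := by
  induction hnk with
  | refl => exact h
  | step _ ih => exact ih.head (stepRel_refl F x)

theorem exists_reachIn_of_reflTransGen {m N : ℕ}
    {F : (Fin m → BitVec N) → (Fin m → BitVec N)} {x y : Fin m → BitVec N}
    (h : Relation.ReflTransGen (stepRel F) x y) : ∃ n, ReachIn F n x y := by
  induction h using Relation.ReflTransGen.head_induction_on with
  | refl => exact ⟨0, fun _ _ => 0, rfl⟩
  | head hxy _ ih => exact ih.imp' (· + 1) fun _ hn => hn.head hxy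

theorem exists_pos_forall_reachIn {m N : ℕ} {F : (Fin m → BitVec N) → (Fin m → BitVec N)}
    {x : Fin m → BitVec N} (h : ∀ y, Relation.ReflTransGen (stepRel F) x y) :
    ∃ n, 0 < n ∧ ∀ y, ReachIn F n x y := by
  choose n hn using fun y => exists_reachIn_of_reflTransGen (h y)
  have : Finite (BitVec N) := Finite.of_injective BitVec.toFin fun _ _ => BitVec.eq_of_toFin_eq
  obtain ⟨M, hM⟩ := (Set.finite_range n).bddAbove
  exact ⟨M + 1, M.succ_pos, fun y => (hn y).mono ((hM ⟨y, rfl⟩).trans M.le_succ)⟩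

theorem abs_bvVal_sub_div_le (Q : ℕ) {N : ℕ} (hN : 1 ≤ N) (a b : BitVec N) (k : ℕ) :
    |bvVal Q a - bvVal Q b| / 2 ^ (N * (k + 1)) ≤ (1 / 2 : ℝ) ^ k := by
  have bound (c : BitVec N) : 0 ≤ bvVal Q c ∧ bvVal Q c ≤ 2 ^ N := by
    refine ⟨by unfold bvVal; positivity, ?_⟩
    have hc : (c.toNat : ℝ) ≤ 2 ^ N := by exact_mod_cast c.isLt.le
    exact (div_le_self (by positivity) (one_le_pow₀ one_le_two)).trans hc
  have habs : |bvVal Q a - bvVal Q b| ≤ 2 ^ N :=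
    abs_sub_le_of_nonneg_of_le (bound a).1 (bound a).2 (bound b).1 (bound b).2
  have hpow : (2 : ℝ) ^ k ≤ 2 ^ (N * k) :=
    pow_le_pow_right₀ one_le_two (Nat.le_mul_of_pos_left k hN)
  rw [div_le_iff₀ (by positivity), mul_add, mul_one, pow_add, ← mul_assoc]
  refine habs.trans (le_mul_of_one_le_left (by positivity) ?_)
  rw [one_div, inv_pow, inv_mul_eq_div, one_le_div (by positivity)]
  exact hpow

theorem dSeq_le_of_agree (Q : ℕ) {N : ℕ} (hN : 1 ≤ N) {w v : ℕ → BitVec N} {K : ℕ}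
    (h : ∀ k < K, w k = v k) : dSeq Q w v ≤ 2 * (1 / 2 : ℝ) ^ K := by
  have hs : Summable fun k => |bvVal Q (w k) - bvVal Q (v k)| / 2 ^ (N * (k + 1)) :=
    summable_geometric_two.of_nonneg_of_le (fun _ => by positivity)
      fun k => abs_bvVal_sub_div_le Q hN (w k) (v k) k
  have hzero : ∑ k ∈ Finset.range K,
      |bvVal Q (w k) - bvVal Q (v k)| / 2 ^ (N * (k + 1)) = 0 :=
    Finset.sum_eq_zero fun k hk => by simp [h k (Finset.mem_range.mp hk)]
  rw [dSeq, ← hs.sum_add_tsum_nat_add K, hzero, zero_add]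
  refine le_of_le_of_eq (b := ∑' k : ℕ, (1 / 2 : ℝ) ^ k * (1 / 2 : ℝ) ^ K) ?_
    (by rw [tsum_mul_right, tsum_geometric_two])
  refine ((summable_nat_add_iff K).2 hs).tsum_le_tsum (fun k => ?_)
    (summable_geometric_two.mul_right _)
  rw [← pow_add]
  exact abs_bvVal_sub_div_le Q hN _ _ _

theorem dE_splice_le (Q : ℕ) {m N : ℕ} (hN : 1 ≤ N) (K : ℕ) (c w : Fin m → ℕ → BitVec N)
    (x : Fin m → BitVec N) : dE Q (c, x) (splice K c w, x) ≤ m * (2 * (1 / 2 : ℝ) ^ K) := by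
  have h := Finset.sum_le_card_nsmul Finset.univ (fun j => dSeq Q (c j) (splice K c w j))
    (2 * (1 / 2 : ℝ) ^ K)
    fun j _ => dSeq_le_of_agree Q hN fun k hk => by simp [splice, hk]
  simpa [dE] using h

theorem exists_forall_dE_splice_lt (Q : ℕ) {m N : ℕ} (hN : 1 ≤ N) {ε : ℝ} (hε : 0 < ε) :
    ∃ K, ∀ (c w : Fin m → ℕ → BitVec N) (x : Fin m → BitVec N),
      dE Q (c, x) (splice K c w, x) < ε := by
  have ht : Filter.Tendsto (fun K : ℕ => (m : ℝ) * (2 * (1 / 2 : ℝ) ^ K)) Filter.atTop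
      (nhds (m * (2 * 0))) :=
    ((tendsto_pow_atTop_nhds_zero_of_lt_one (by norm_num) (by norm_num)).const_mul _).const_mul _
  obtain ⟨K, hK⟩ := (ht.eventually_lt_const (by simpa using hε)).exists
  exact ⟨K, fun c w x => (dE_splice_le Q hN K c w x).trans_lt hK⟩

/-- if the state transition diagram of `G_F` is strongly
connected, then for every nonempty open set `U ⊆ 𝓔` there is a positive
integer `n₀` with `G_F^{n₀}(U) = 𝓔`. -/
theorem statement8 (m P Q : ℕ) (hm : 1 ≤ m) (hN : 1 ≤ P + Q)
    (F : (Fin m → BitVec (P + Q)) → (Fin m → BitVec (P + Q)))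
    (hsc : ∀ x y : Fin m → BitVec (P + Q), Relation.ReflTransGen (stepRel F) x y)
    (U : Set ((Fin m → ℕ → BitVec (P + Q)) × (Fin m → BitVec (P + Q))))
    (hne : U.Nonempty)
    (hopen : ∀ x ∈ U, ∃ ε > (0 : ℝ), ∀ y, dE Q x y < ε → y ∈ U) :
    ∃ n₀ : ℕ, 0 < n₀ ∧ (GF F)^[n₀] '' U = Set.univ := by
  obtain ⟨⟨w, x⟩, hwx⟩ := hne
  obtain ⟨ε, hε, hball⟩ := hopen _ hwx
  obtain ⟨K, hK⟩ := exists_forall_dE_splice_lt (m := m) Q hN hε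
  obtain ⟨L, hL, hreach⟩ := exists_pos_forall_reachIn (hsc ((GF F)^[K] (w, x)).2)
  refine ⟨L + K, by omega, Set.eq_univ_of_forall ?_⟩
  rintro ⟨v, y⟩
  obtain ⟨c, hc⟩ := hreach y
  refine ⟨(splice K w (splice L c v), x), hball _ (hK _ _ _), ?_⟩
  rw [Function.iterate_add_apply, GF_iterate_splice, GF_iterate_splice, hc]
end

section
/- (Theorem 2) Let F : V^m → V^m. If the state transition diagram of G_F is strongly connected, then G_F is topologically mixing on the compact metric space (𝓔, d): for all nonempty open sets U, W ⊆ 𝓔, there exists a positive integer n₀ such that G_F^n(U) ∩ W ≠ ∅ for every n ≥ n₀. -/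
/-- Put the masks `c` in front of the sequences `w`. -/
def consSeq {m N : ℕ} (c : Fin m → BitVec N) (w : Fin m → ℕ → BitVec N) :
    Fin m → ℕ → BitVec N :=
  fun j k => Nat.casesOn k (c j) (w j)

theorem GF_consSeq {m N : ℕ} (F : (Fin m → BitVec N) → (Fin m → BitVec N))
    (c : Fin m → BitVec N) (w : Fin m → ℕ → BitVec N) (x : Fin m → BitVec N) :
    GF F (consSeq c w, x) = (w, fun j => (x j &&& ~~~(c j)) ||| (F x j &&& c j)) :=
  rfl

theorem exists_GF_eq_of_stepRel {m N : ℕ} {F : (Fin m → BitVec N) → (Fin m → BitVec N)}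
    {x y : Fin m → BitVec N} (h : stepRel F x y) (w : Fin m → ℕ → BitVec N) :
    ∃ w', GF F (w', x) = (w, y) := by
  obtain ⟨c, hc⟩ := h
  exact ⟨consSeq c w, by rw [GF_consSeq, ← funext hc]⟩

/-- If `y` is reachable from `x`, then every long enough number of iterations of `GF F` leads
from some point over `x` to any prescribed point over `y`. -/
theorem exists_iterate_GF_eq_of_reachable {m N : ℕ}
    {F : (Fin m → BitVec N) → (Fin m → BitVec N)} {x y : Fin m → BitVec N}
    (h : Relation.ReflTransGen (stepRel F) x y) :
    ∃ L : ℕ, ∀ n ≥ L, ∀ w, ∃ w', (GF F)^[n] (w', x) = (w, y) := by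
  induction h using Relation.ReflTransGen.head_induction_on with
  | refl =>
    refine ⟨0, fun n _ => ?_⟩
    induction n with
    | zero => exact fun w => ⟨w, rfl⟩
    | succ n ih =>
      intro w
      obtain ⟨w', hw'⟩ := ih (Nat.zero_le n) w
      obtain ⟨w'', hw''⟩ := exists_GF_eq_of_stepRel (stepRel_refl F y) w'
      exact ⟨w'', by rw [Function.iterate_succ_apply, hw'', hw']⟩
  | head hxz _ ih =>
    obtain ⟨L, hL⟩ := ih
    refine ⟨L + 1, fun n hn w => ?_⟩
    obtain ⟨k, rfl⟩ : ∃ k, n = k + 1 := ⟨n - 1, by omega⟩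
    obtain ⟨w', hw'⟩ := hL k (by omega) w
    obtain ⟨w'', hw''⟩ := exists_GF_eq_of_stepRel hxz w'
    exact ⟨w'', by rw [Function.iterate_succ_apply, hw'', hw']⟩

/-- The sequences of a point can be replaced from index `K` on so that the `K`-th iterate has
prescribed sequences and an unchanged state. -/
theorem exists_iterate_GF_eq_of_prefix {m N : ℕ}
    (F : (Fin m → BitVec N) → (Fin m → BitVec N)) (K : ℕ)
    (w w₂ : Fin m → ℕ → BitVec N) (x : Fin m → BitVec N) :
    ∃ w', (∀ j, ∀ k < K, w' j k = w j k) ∧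
      (GF F)^[K] (w', x) = (w₂, ((GF F)^[K] (w, x)).2) := by
  induction K generalizing w x with
  | zero => exact ⟨w₂, by simp, rfl⟩
  | succ K ih =>
    obtain ⟨w', hw', hG⟩ := ih (GF F (w, x)).1 (GF F (w, x)).2
    refine ⟨consSeq (fun j => w j 0) w', fun j k hk => ?_, ?_⟩
    · cases k with
      | zero => rfl
      | succ k => exact hw' j k (by omega)
    · rw [Function.iterate_succ_apply, Function.iterate_succ_apply, GF_consSeq]
      exact hG

theorem abs_bvVal_sub_le (Q : ℕ) {N : ℕ} (a b : BitVec N) :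
    |bvVal Q a - bvVal Q b| ≤ 2 ^ N := by
  have key : ∀ c : BitVec N, 0 ≤ bvVal Q c ∧ bvVal Q c ≤ 2 ^ N := fun c =>
    ⟨by unfold bvVal; positivity,
      (div_le_self (Nat.cast_nonneg _) (one_le_pow₀ one_le_two)).trans
        (by exact_mod_cast c.isLt.le)⟩
  rw [abs_le]
  constructor <;> linarith [(key a).1, (key a).2, (key b).1, (key b).2]

theorem dSeq_le_of_prefix (Q : ℕ) {N : ℕ} (hN : 1 ≤ N) (K : ℕ) {w w₂ : ℕ → BitVec N}
    (h : ∀ k < K, w k = w₂ k) : dSeq Q w w₂ ≤ 2 * (1 / 2) ^ K := by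
  have hterm : ∀ k, |bvVal Q (w k) - bvVal Q (w₂ k)| / 2 ^ (N * (k + 1)) ≤ (1 / 2 : ℝ) ^ k := by
    intro k
    calc |bvVal Q (w k) - bvVal Q (w₂ k)| / 2 ^ (N * (k + 1))
        ≤ 2 ^ N / 2 ^ (N * (k + 1)) := by gcongr; exact abs_bvVal_sub_le Q _ _
      _ = 1 / 2 ^ (N * k) := by rw [mul_add, mul_one, pow_add]; field_simp
      _ ≤ 1 / 2 ^ k := by
        gcongr
        · exact one_le_two
        · exact Nat.le_mul_of_pos_left k hN
      _ = (1 / 2 : ℝ) ^ k := by rw [one_div_pow]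
  have hsum := Summable.of_nonneg_of_le (fun k => by positivity) hterm summable_geometric_two
  have hgeom : HasSum (fun k => (1 / 2 : ℝ) ^ (k + K)) (2 * (1 / 2) ^ K) := by
    simpa only [pow_add] using hasSum_geometric_two.mul_right ((1 / 2 : ℝ) ^ K)
  unfold dSeq
  rw [← hsum.sum_add_tsum_nat_add K, Finset.sum_eq_zero fun k hk => by
    rw [h k (Finset.mem_range.mp hk), sub_self, abs_zero, zero_div], zero_add, ← hgeom.tsum_eq]
  exact ((summable_nat_add_iff K).mpr hsum).tsum_le_tsum (fun k => hterm _) hgeom.summable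

theorem dE_le_of_prefix (Q : ℕ) {m N : ℕ} (hN : 1 ≤ N) (K : ℕ)
    {w w₂ : Fin m → ℕ → BitVec N} (x : Fin m → BitVec N)
    (h : ∀ j, ∀ k < K, w j k = w₂ j k) : dE Q (w, x) (w₂, x) ≤ m * (2 * (1 / 2) ^ K) := by
  have := Finset.sum_le_sum fun j (_ : j ∈ Finset.univ) => dSeq_le_of_prefix Q hN K (h j)
  simpa [dE] using this

/-- Theorem 2: if the state transition diagram of `G_F` is
strongly connected, then `G_F` is topologically mixing on the compact metric
space `(𝓔, d)`: for all nonempty open sets `U, W ⊆ 𝓔` there is a positive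
integer `n₀` such that `G_F^n(U) ∩ W ≠ ∅` for every `n ≥ n₀`. -/
theorem statement9 (m P Q : ℕ) (hm : 1 ≤ m) (hN : 1 ≤ P + Q)
    (F : (Fin m → BitVec (P + Q)) → (Fin m → BitVec (P + Q)))
    (hsc : ∀ x y : Fin m → BitVec (P + Q), Relation.ReflTransGen (stepRel F) x y)
    (U W : Set ((Fin m → ℕ → BitVec (P + Q)) × (Fin m → BitVec (P + Q))))
    (hUne : U.Nonempty) (hWne : W.Nonempty)
    (hUopen : ∀ x ∈ U, ∃ ε > (0 : ℝ), ∀ y, dE Q x y < ε → y ∈ U)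
    (hWopen : ∀ x ∈ W, ∃ ε > (0 : ℝ), ∀ y, dE Q x y < ε → y ∈ W) :
    ∃ n₀ : ℕ, 0 < n₀ ∧ ∀ n ≥ n₀, ((GF F)^[n] '' U ∩ W).Nonempty := by
  obtain ⟨⟨w, x⟩, hu⟩ := hUne
  obtain ⟨⟨w₂, x₂⟩, hv⟩ := hWne
  obtain ⟨ε, hε, hball⟩ := hUopen _ hu
  obtain ⟨K, hK⟩ : ∃ K : ℕ, (m : ℝ) * (2 * (1 / 2) ^ K) < ε := by
    have hlim : Filter.Tendsto (fun K : ℕ => (m : ℝ) * (2 * (1 / 2) ^ K)) Filter.atTop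
        (nhds 0) := by
      simpa using ((tendsto_pow_atTop_nhds_zero_of_lt_one (r := (1 / 2 : ℝ)) (by norm_num)
        (by norm_num)).const_mul 2).const_mul (m : ℝ)
    exact (hlim.eventually (gt_mem_nhds hε)).exists
  obtain ⟨L, hL⟩ := exists_iterate_GF_eq_of_reachable (hsc ((GF F)^[K] (w, x)).2 x₂)
  refine ⟨L + K + 1, Nat.succ_pos _, fun n hn => ?_⟩
  obtain ⟨w₁, hw₁⟩ := hL (n - K) (by omega) w₂
  obtain ⟨w', hpre, hw'⟩ := exists_iterate_GF_eq_of_prefix F K w w₁ x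
  refine ⟨(w₂, x₂), ⟨(w', x), hball _ ?_, ?_⟩, hv⟩
  · exact (dE_le_of_prefix Q hN K x fun j k hk => (hpre j k hk).symm).trans_lt hK
  · rw [← Nat.sub_add_cancel (show K ≤ n by omega), Function.iterate_add_apply, hw', hw₁]
end

section
/- (Theorem 5) Let m ≥ 1 and let f = (f_1,…,f_m) : {0,1}^m → {0,1}^m be any Boolean map. For each N ≥ 1, let F^{(N)} : (BitVec N)^m → (BitVec N)^m be the bitwise extension of f, i.e., the k-th bit of F^{(N)}_j(x_1,…,x_m) equals f_j applied to the k-th bits of x_1,…,x_m, for every bit position k. Let 𝒢_N be the directed graph with vertex set (BitVec N)^m and an edge from x to y iff there exist masks c_1,…,c_m ∈ BitVec N such that y_j = (x_j AND (NOT c_j)) OR (F^{(N)}_j(x) AND c_j) for every j. If 𝒢_1 is strongly connected, then 𝒢_N is strongly connected for every N ≥ 1. -/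
/-!
`BitVec N` is the type of N-bit binary words with bitwise AND (`&&&`),
OR (`|||`) and NOT (`~~~`); `(b : BitVec N).getLsbD k` is its k-th bit.
Given a Boolean map `f : {0,1}^m → {0,1}^m`, its bitwise extension
`F N : (BitVec N)^m → (BitVec N)^m` is characterized by: for every bit
position `k < N`, the k-th bit of `F N x j` is `f` applied to the k-th bits
of `x_1, …, x_m`, evaluated at coordinate `j`.
`𝒢_N` is the directed graph on `(BitVec N)^m` with an edge from `x` to `y`
iff there are masks `c_1,…,c_m` with
`y_j = (x_j AND (NOT c_j)) OR (F N x j AND c_j)` for all `j`; strong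
connectivity is expressed by `Relation.ReflTransGen` of the edge relation.
-/

/-- The edge relation of the graph `𝒢_N`. -/
def gEdge {m N : ℕ} (FN : (Fin m → BitVec N) → (Fin m → BitVec N))
    (x y : Fin m → BitVec N) : Prop :=
  ∃ c : Fin m → BitVec N, ∀ j, y j = (x j &&& ~~~(c j)) ||| (FN x j &&& c j)

/-- One step of the asynchronous Boolean dynamics of `f`: every coordinate either keeps its value
or is updated by `f`. -/
def AsyncStep {m : ℕ} (f : (Fin m → Bool) → (Fin m → Bool)) (u v : Fin m → Bool) : Prop :=
  ∀ j, v j = u j ∨ v j = f u j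

/-- The tuple of words whose `k`-th bits form the Boolean state `g k`. -/
def wordsOfSlices {m N : ℕ} (g : Fin N → Fin m → Bool) : Fin m → BitVec N :=
  fun j => BitVec.ofFnLE fun k => g k j

theorem getLsbD_wordsOfSlices {m N : ℕ} (g : Fin N → Fin m → Bool) (k : Fin N) (j : Fin m) :
    (wordsOfSlices g j).getLsbD k = g k j := by
  simp [wordsOfSlices]

theorem wordsOfSlices_getLsbD {m N : ℕ} (x : Fin m → BitVec N) :
    wordsOfSlices (fun (k : Fin N) j => (x j).getLsbD k) = x := by
  funext j
  refine BitVec.eq_of_getLsbD_eq fun k hk => ?_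
  exact getLsbD_wordsOfSlices _ ⟨k, hk⟩ j

theorem gEdge_iff_forall_asyncStep {m N : ℕ} {f : (Fin m → Bool) → (Fin m → Bool)}
    {FN : (Fin m → BitVec N) → (Fin m → BitVec N)}
    (hF : ∀ (x : Fin m → BitVec N) (j : Fin m) (k : ℕ), k < N →
      (FN x j).getLsbD k = f (fun i => (x i).getLsbD k) j)
    (x y : Fin m → BitVec N) :
    gEdge FN x y ↔ ∀ k : Fin N,
      AsyncStep f (fun j => (x j).getLsbD k) (fun j => (y j).getLsbD k) := by
  constructor
  · rintro ⟨c, hc⟩ k j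
    have h := congrArg (fun b => b.getLsbD k) (hc j)
    simp only [BitVec.getLsbD_or, BitVec.getLsbD_and, BitVec.getLsbD_not, hF x j k k.2] at h
    cases hck : (c j).getLsbD k <;> simp_all
  · intro h
    refine ⟨fun j => x j ^^^ y j, fun j => BitVec.eq_of_getLsbD_eq fun k hk => ?_⟩
    simp only [BitVec.getLsbD_or, BitVec.getLsbD_and, BitVec.getLsbD_not, BitVec.getLsbD_xor,
      hF x j k hk, hk, decide_true, Bool.true_and]
    have hj := h ⟨k, hk⟩ j
    dsimp only at hj
    generalize f _ j = w at *
    revert hj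
    cases (x j).getLsbD k <;> cases (y j).getLsbD k <;> cases w <;> decide

theorem reflTransGen_gEdge_update {m N : ℕ} {f : (Fin m → Bool) → (Fin m → Bool)}
    {FN : (Fin m → BitVec N) → (Fin m → BitVec N)}
    (hF : ∀ (x : Fin m → BitVec N) (j : Fin m) (k : ℕ), k < N →
      (FN x j).getLsbD k = f (fun i => (x i).getLsbD k) j)
    (g : Fin N → Fin m → Bool) (k : Fin N) {v : Fin m → Bool}
    (h : Relation.ReflTransGen (AsyncStep f) (g k) v) :
    Relation.ReflTransGen (gEdge FN) (wordsOfSlices g)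
      (wordsOfSlices (Function.update g k v)) := by
  have := h.lift (p := gEdge FN) (fun u => wordsOfSlices (Function.update g k u)) fun u w huw => by
    rw [Function.onFun, gEdge_iff_forall_asyncStep hF]
    intro l
    simp only [getLsbD_wordsOfSlices]
    by_cases hl : l = k
    · subst hl
      simpa using huw
    · simp [hl, AsyncStep]
  simpa [Function.onFun] using this

/-- Theorem 5: let `f : {0,1}^m → {0,1}^m` be a Boolean map and
for each `N` let `F N` be its bitwise extension.  If `𝒢_1` is strongly
connected, then `𝒢_N` is strongly connected for every `N ≥ 1`. -/
theorem statement13 (m : ℕ) (hm : 1 ≤ m)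
    (f : (Fin m → Bool) → (Fin m → Bool))
    (F : ∀ N : ℕ, (Fin m → BitVec N) → (Fin m → BitVec N))
    (hF : ∀ (N : ℕ) (x : Fin m → BitVec N) (j : Fin m) (k : ℕ), k < N →
      (F N x j).getLsbD k = f (fun i => (x i).getLsbD k) j)
    (h1 : ∀ a b : Fin m → BitVec 1, Relation.ReflTransGen (gEdge (F 1)) a b)
    (N : ℕ) (hN : 1 ≤ N) :
    ∀ a b : Fin m → BitVec N, Relation.ReflTransGen (gEdge (F N)) a b := by
  have hf : ∀ u v, Relation.ReflTransGen (AsyncStep f) u v := fun u v => by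
    have h := (h1 (wordsOfSlices fun _ => u) (wordsOfSlices fun _ => v)).lift
      (p := AsyncStep f) (fun x j => (x j).getLsbD (0 : Fin 1))
      fun x y hxy => (gEdge_iff_forall_asyncStep (hF 1) x y).1 hxy 0
    simpa only [Function.onFun, getLsbD_wordsOfSlices] using h
  intro a b
  rw [← wordsOfSlices_getLsbD a, ← wordsOfSlices_getLsbD b]
  generalize (fun (k : Fin N) j => (a j).getLsbD k) = g
  generalize (fun (k : Fin N) j => (b j).getLsbD k) = h
  have key : ∀ s : Finset (Fin N), Relation.ReflTransGen (gEdge (F N)) (wordsOfSlices g)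
      (wordsOfSlices (s.piecewise h g)) := fun s => by
    induction s using Finset.induction_on with
    | empty => rw [Finset.piecewise_empty]
    | insert k s _ ih =>
      rw [Finset.piecewise_insert]
      exact ih.trans (reflTransGen_gEdge_update (hF N) _ k (hf _ _))
  simpa using key Finset.univ
end
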